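/- Fix k ≥ 0 and α ∈ ℝ, and let F₂(x,v) = −kxv²/(1 + kx²) − α²x/(1 + kx²)³. Define the non-mechanical Lagrangian L₂(x,v) = (k/12)·v⁴(1 + kx²)² − (α²/2)·v² + α⁴x²(2 + kx²)/(4(1 + kx²)²). Then for all (x,v) ∈ ℝ²: (i) ∂²L₂/∂v²(x,v) = k(1 + kx²)²v² − α², i.e. L₂ is the Lagrangian associated with the Jacobi multiplier μ₂ = k(1+kx²)²v² − α²; and (ii) the Euler–Lagrange identity holds: ∂L₂/∂x(x,v) − v·∂²L₂/∂x∂v(x,v) − F₂(x,v)·∂²L₂/∂v²(x,v) = 0. Hence L₂ is a Lagrangian for the second nonlinear oscillator. -/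

import Mathlib

/-- The non-mechanical Lagrangian
`L₂(x,v) = (k/12)v⁴(1+kx²)² − (α²/2)v² + α⁴x²(2+kx²)/(4(1+kx²)²)` satisfies
`∂²L₂/∂v² = k(1+kx²)²v² − α²` (the Jacobi multiplier `μ₂`) and the Euler–Lagrange
identity for the second nonlinear oscillator `ẍ = F₂(x,ẋ)`,
`F₂(x,v) = −kxv²/(1+kx²) − α²x/(1+kx²)³`, `k ≥ 0`. -/
theorem lagrangian_L2_second_oscillator
    (k α : ℝ) (hk : 0 ≤ k) (F₂ L₂ : ℝ → ℝ → ℝ)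
    (hF : ∀ x v : ℝ, F₂ x v =
      -(k * x * v ^ 2 / (1 + k * x ^ 2)) - α ^ 2 * x / (1 + k * x ^ 2) ^ 3)
    (hL : ∀ x v : ℝ, L₂ x v =
      (k / 12) * v ^ 4 * (1 + k * x ^ 2) ^ 2 - (α ^ 2 / 2) * v ^ 2
        + α ^ 4 * x ^ 2 * (2 + k * x ^ 2) / (4 * (1 + k * x ^ 2) ^ 2)) :
    ∀ x v : ℝ,
      deriv (deriv (L₂ x)) v = k * (1 + k * x ^ 2) ^ 2 * v ^ 2 - α ^ 2 ∧
      deriv (fun x' => L₂ x' v) x - v * deriv (fun x' => deriv (L₂ x') v) x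
        - F₂ x v * deriv (deriv (L₂ x)) v = 0 := by
  have hD (x : ℝ) : 1 + k * x ^ 2 ≠ 0 := by positivity
  have hLv (x v : ℝ) :
      deriv (L₂ x) v = k / 3 * v ^ 3 * (1 + k * x ^ 2) ^ 2 - α ^ 2 * v := by
    rw [funext (hL x)]
    refine HasDerivAt.deriv (HasDerivAt.congr_deriv ((((((hasDerivAt_id v).pow 4).const_mul (k / 12)).mul_const
      ((1 + k * x ^ 2) ^ 2)).sub (((hasDerivAt_id v).pow 2).const_mul (α ^ 2 / 2))).add_const
      (α ^ 4 * x ^ 2 * (2 + k * x ^ 2) / (4 * (1 + k * x ^ 2) ^ 2))) ?_)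
    simp
    ring
  have hLvv (x v : ℝ) :
      deriv (deriv (L₂ x)) v = k * (1 + k * x ^ 2) ^ 2 * v ^ 2 - α ^ 2 := by
    rw [funext (hLv x)]
    refine HasDerivAt.deriv (HasDerivAt.congr_deriv (((((hasDerivAt_id v).pow 3).const_mul (k / 3)).mul_const
      ((1 + k * x ^ 2) ^ 2)).sub ((hasDerivAt_id v).const_mul (α ^ 2))) ?_)
    simp
    ring
  have hDx (c x : ℝ) : HasDerivAt (fun y : ℝ => c + k * y ^ 2) (2 * k * x) x := by
    refine (((hasDerivAt_pow 2 x).const_mul k).const_add c).congr_deriv ?_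
    norm_num
    ring
  have hLx (x v : ℝ) :
      deriv (fun y => L₂ y v) x =
        k ^ 2 / 3 * x * v ^ 4 * (1 + k * x ^ 2) + α ^ 4 * x / (1 + k * x ^ 2) ^ 3 := by
    simp only [hL]
    refine HasDerivAt.deriv (HasDerivAt.congr_deriv (((((hDx 1 x).pow 2).const_mul (k / 12 * v ^ 4)).sub_const
      (α ^ 2 / 2 * v ^ 2)).add ((((hasDerivAt_pow 2 x).const_mul (α ^ 4)).mul (hDx 2 x)).div
      (((hDx 1 x).pow 2).const_mul 4) (mul_ne_zero four_ne_zero (pow_ne_zero 2 (hD x))))) ?_)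
    have := hD x
    simp
    field_simp
    ring
  have hLxv (x v : ℝ) :
      deriv (fun y => deriv (L₂ y) v) x = 4 * k ^ 2 / 3 * x * v ^ 3 * (1 + k * x ^ 2) := by
    simp only [hLv]
    refine HasDerivAt.deriv (HasDerivAt.congr_deriv ((((hDx 1 x).pow 2).const_mul (k / 3 * v ^ 3)).sub_const (α ^ 2 * v)) ?_)
    norm_num
    ring
  intro x v
  refine ⟨hLvv x v, ?_⟩
  rw [hLx, hLxv, hLvv, hF]
  have := hD x
  field_simp
  ring
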